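/- Let f : 𝔽₂ⁿ → 𝔽₂ be a Boolean function, with nonlinearity polynomial coefficients c : 𝔽₂^{n+1} → ℚ defined by c(0) = Σ_{u} F(u) and c(v) = (−2)^{w(v)} · Σ_{ṽ ⪯ u} (F(u) − 1/2) for v = (v₀, ṽ) ≠ 0, where F is the 0/1 integer lift of f. For t ∈ ℕ, there exists a point a ∈ {0,1}^{n+1} ⊂ ℚ^{n+1} with Σ_{v ∈ 𝔽₂^{n+1}} c(v) · Π_{i=0}^{n} aᵢ^{vᵢ} = t if and only if there exists an affine Boolean function α : 𝔽₂ⁿ → 𝔽₂ with d(f, α) = t. -/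

import Mathlib

open Finset

/-- Hamming weight of a vector over 𝔽₂. -/
def wt {m : ℕ} (v : Fin m → ZMod 2) : ℕ :=
  (univ.filter (fun i : Fin m => v i = 1)).card

lemma zmod_two_eq_zero_or_one : ∀ x : ZMod 2, x = 0 ∨ x = 1 := by decide

/-- The nontrivial additive character of `𝔽₂` with values in `ℚ`. -/
def signChar (x : ZMod 2) : ℚ := if x = 1 then -1 else 1

lemma signChar_add (x y : ZMod 2) : signChar (x + y) = signChar x * signChar y := by
  obtain rfl | rfl := zmod_two_eq_zero_or_one x <;>
    obtain rfl | rfl := zmod_two_eq_zero_or_one y <;> simp [signChar, show (1 + 1 : ZMod 2) = 0 from rfl]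

lemma signChar_sum {ι : Type*} (s : Finset ι) (g : ι → ZMod 2) :
    signChar (∑ i ∈ s, g i) = ∏ i ∈ s, signChar (g i) := by
  classical
  induction s using Finset.induction_on with
  | empty => simp [signChar]
  | insert i s hi ih => rw [sum_insert hi, prod_insert hi, signChar_add, ih]

lemma neg_two_pow_wt_mul_prod {m : ℕ} (a : Fin m → ℚ) (v : Fin m → ZMod 2) :
    (-2 : ℚ) ^ wt v * ∏ i, a i ^ (if v i = 1 then 1 else 0 : ℕ) =
      ∏ i, if v i = 1 then -2 * a i else 1 := by
  have h : (-2 : ℚ) ^ wt v = ∏ i, if v i = 1 then (-2 : ℚ) else 1 := by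
    rw [wt, ← prod_filter, prod_const]
  rw [h, ← prod_mul_distrib]
  refine prod_congr rfl fun i _ => ?_
  split_ifs <;> simp

/-- The signed sum of the monomials supported below `u`, evaluated at the 0/1 lift of `b`,
is the character value of the inner product of `b` and `u`. -/
lemma sum_monomials_eq_signChar {m : ℕ} (b u : Fin m → ZMod 2) (a : Fin m → ℚ)
    (ha : ∀ i, a i = if b i = 1 then 1 else 0) :
    (∑ v : Fin m → ZMod 2, if ∀ i, v i = 1 → u i = 1 then
        (-2 : ℚ) ^ wt v * ∏ i, a i ^ (if v i = 1 then 1 else 0 : ℕ) else 0) =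
      signChar (∑ i, b i * u i) := by
  rw [signChar_sum]
  have hfactor (i : Fin m) : signChar (b i * u i) =
      ∑ x : ZMod 2, if x = 1 then (if u i = 1 then -2 * a i else 0) else 1 := by
    rw [ha i]
    generalize b i = y
    generalize u i = z
    have hsum (g : ZMod 2 → ℚ) : ∑ x, g x = g 0 + g 1 := Fin.sum_univ_two g
    rw [hsum]
    obtain rfl | rfl := zmod_two_eq_zero_or_one y <;>
    obtain rfl | rfl := zmod_two_eq_zero_or_one z <;> norm_num [signChar]
  simp_rw [hfactor]
  rw [prod_univ_sum, Fintype.piFinset_univ]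
  refine sum_congr rfl fun v _ => ?_
  split_ifs with h
  · rw [neg_two_pow_wt_mul_prod]
    refine prod_congr rfl fun i _ => ?_
    by_cases hv : v i = 1
    · simp [hv, h i hv]
    · simp [hv]
  · push Not at h
    obtain ⟨i, hv, hu⟩ := h
    exact (prod_eq_zero (mem_univ i) (by simp [hv, hu])).symm

/-- At the 0/1 lift of `b`, the nonlinearity polynomial is the distance from `f` to the affine
function with coefficients `b`. -/
lemma nlp_eval_eq_dist (n : ℕ) (f : (Fin n → ZMod 2) → ZMod 2)
    (F : (Fin n → ZMod 2) → ℚ) (hF : ∀ x, F x = if f x = 1 then 1 else 0)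
    (c : (Fin (n + 1) → ZMod 2) → ℚ)
    (hc0 : c 0 = ∑ u : Fin n → ZMod 2, F u)
    (hcv : ∀ v : Fin (n + 1) → ZMod 2, v ≠ 0 →
      c v = (-2 : ℚ) ^ wt v *
        ∑ u ∈ univ.filter (fun u : Fin n → ZMod 2 => ∀ i, v i.succ = 1 → u i = 1),
          (F u - 1 / 2))
    (b : Fin (n + 1) → ZMod 2) (a : Fin (n + 1) → ℚ)
    (ha : ∀ i, a i = if b i = 1 then 1 else 0) :
    (∑ v : Fin (n + 1) → ZMod 2,
        c v * ∏ i : Fin (n + 1), a i ^ (if v i = 1 then 1 else 0 : ℕ)) =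
      ((univ.filter (fun x : Fin n → ZMod 2 =>
        f x ≠ b 0 + ∑ i : Fin n, b i.succ * x i)).card : ℚ) := by
  have hc (v : Fin (n + 1) → ZMod 2) : c v = (if v = 0 then ∑ _u : Fin n → ZMod 2, (1 / 2 : ℚ)
      else 0) + (-2 : ℚ) ^ wt v *
        ∑ u ∈ univ.filter (fun u : Fin n → ZMod 2 => ∀ i, v i.succ = 1 → u i = 1),
          (F u - 1 / 2) := by
    by_cases hv : v = 0
    · subst hv
      rw [hc0]
      simp [wt, sum_sub_distrib]
    · rw [hcv v hv, if_neg hv, zero_add]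
  have hmono (u : Fin n → ZMod 2) :
      (∑ v : Fin (n + 1) → ZMod 2, if ∀ i : Fin n, v i.succ = 1 → u i = 1 then
        (-2 : ℚ) ^ wt v * ∏ i, a i ^ (if v i = 1 then 1 else 0 : ℕ) else 0) =
      signChar (b 0 + ∑ i : Fin n, b i.succ * u i) := by
    have h := sum_monomials_eq_signChar b (Fin.cons 1 u) a ha
    simpa [Fin.forall_fin_succ, Fin.sum_univ_succ] using h
  have hterm (v : Fin (n + 1) → ZMod 2) :
      c v * ∏ i, a i ^ (if v i = 1 then 1 else 0 : ℕ) =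
      (if v = 0 then ∑ _u : Fin n → ZMod 2, (1 / 2 : ℚ) else 0) +
      ∑ u : Fin n → ZMod 2, (F u - 1 / 2) * (if ∀ i : Fin n, v i.succ = 1 → u i = 1 then
        (-2 : ℚ) ^ wt v * ∏ i, a i ^ (if v i = 1 then 1 else 0 : ℕ) else 0) := by
    rw [hc, add_mul]
    congr 1
    · by_cases hv : v = 0 <;> simp [hv]
    · rw [sum_filter, mul_right_comm, mul_sum]
      refine sum_congr rfl fun u _ => ?_
      split_ifs <;> ring
  simp_rw [hterm]
  rw [sum_add_distrib, sum_comm]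
  simp_rw [← mul_sum, hmono]
  rw [sum_ite_eq' univ (0 : Fin (n + 1) → ZMod 2), if_pos (mem_univ _), ← sum_add_distrib,
    card_filter, Nat.cast_sum]
  refine sum_congr rfl fun u _ => ?_
  rw [hF]
  generalize f u = y
  generalize b 0 + ∑ i : Fin n, b i.succ * u i = z
  obtain rfl | rfl := zmod_two_eq_zero_or_one y <;>
    obtain rfl | rfl := zmod_two_eq_zero_or_one z <;> norm_num [signChar]

/-- The nonlinearity polynomial of `f` takes the value `t` at some point of
`{0,1}^{n+1}` if and only if `f` has Hamming distance `t` from some affine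
Boolean function. -/
theorem nlp_value_iff_dist (n : ℕ) (f : (Fin n → ZMod 2) → ZMod 2)
    (F : (Fin n → ZMod 2) → ℚ) (hF : ∀ x, F x = if f x = 1 then 1 else 0)
    (c : (Fin (n + 1) → ZMod 2) → ℚ)
    (hc0 : c 0 = ∑ u : Fin n → ZMod 2, F u)
    (hcv : ∀ v : Fin (n + 1) → ZMod 2, v ≠ 0 →
      c v = (-2 : ℚ) ^ wt v *
        ∑ u ∈ univ.filter (fun u : Fin n → ZMod 2 => ∀ i, v i.succ = 1 → u i = 1),
          (F u - 1 / 2))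
    (t : ℕ) :
    (∃ a : Fin (n + 1) → ℚ, (∀ i, a i = 0 ∨ a i = 1) ∧
        (∑ v : Fin (n + 1) → ZMod 2,
            c v * ∏ i : Fin (n + 1), a i ^ (if v i = 1 then 1 else 0 : ℕ)) = t)
      ↔ ∃ b : Fin (n + 1) → ZMod 2,
          (univ.filter (fun x : Fin n → ZMod 2 =>
            f x ≠ b 0 + ∑ i : Fin n, b i.succ * x i)).card = t := by
  constructor
  · rintro ⟨a, ha, h⟩
    refine ⟨fun i => if a i = 1 then 1 else 0, ?_⟩
    rw [nlp_eval_eq_dist n f F hF c hc0 hcv (fun i => if a i = 1 then 1 else 0) a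
      fun i => by rcases ha i with h | h <;> simp [h]] at h
    exact_mod_cast h
  · rintro ⟨b, h⟩
    refine ⟨fun i => if b i = 1 then 1 else 0, fun i => ?_, ?_⟩
    · by_cases hb : b i = 1 <;> simp [hb]
    · rw [nlp_eval_eq_dist n f F hF c hc0 hcv b _ fun _ => rfl, h]
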